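/- For every real x ≥ 0 one has (x/e)^x ≤ Γ(1+x) ≤ (1+x)^x, where Γ is the Euler Gamma function (with the convention (0/e)^0 = 1). -/

import Mathlib

open MeasureTheory Set in
/-- The tail `∫_x^∞ t^x e^{-t} dt` already bounds `Γ(1+x)` from below by `(x/e)^x`. -/
theorem div_exp_rpow_le_Gamma_one_add {x : ℝ} (hx : 0 ≤ x) :
    (x / Real.exp 1) ^ x ≤ Real.Gamma (1 + x) := by
  have hint : IntegrableOn (fun t : ℝ => Real.exp (-t) * t ^ (1 + x - 1)) (Ioi 0) :=
    Real.GammaIntegral_convergent (by linarith)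
  have hsub : Ioi x ⊆ Ioi 0 := Ioi_subset_Ioi hx
  rw [Real.Gamma_eq_integral (by linarith)]
  calc (x / Real.exp 1) ^ x = (∫ t in Ioi x, Real.exp (-t)) * x ^ x := by
        rw [integral_exp_neg_Ioi, Real.div_rpow hx (Real.exp_pos 1).le, Real.exp_one_rpow,
          Real.exp_neg]
        ring
    _ = ∫ t in Ioi x, Real.exp (-t) * x ^ x := (integral_mul_const _ _).symm
    _ ≤ ∫ t in Ioi x, Real.exp (-t) * t ^ (1 + x - 1) := by
        refine setIntegral_mono_on ((integrableOn_exp_neg_Ioi x).mul_const _)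
          (hint.mono_set hsub) measurableSet_Ioi fun t ht => ?_
        rw [add_sub_cancel_left]
        have ht' : x ≤ t := le_of_lt ht
        gcongr
    _ ≤ ∫ t in Ioi 0, Real.exp (-t) * t ^ (1 + x - 1) := by
        refine setIntegral_mono_set hint ?_ hsub.eventuallyLE
        filter_upwards [ae_restrict_mem measurableSet_Ioi] with t ht
        have ht' : 0 ≤ t := le_of_lt ht
        exact mul_nonneg (Real.exp_pos _).le (Real.rpow_nonneg ht' _)

/-- By log-convexity, the slope of `log ∘ Γ` on `[1, 1 + x]` is at most its slope on
`[1 + x, 2 + x]`, which is `log (1 + x)`. -/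
theorem Gamma_one_add_le_one_add_rpow {x : ℝ} (hx : 0 ≤ x) :
    Real.Gamma (1 + x) ≤ (1 + x) ^ x := by
  rcases hx.eq_or_lt with rfl | hx
  · simp
  have h1 : 0 < 1 + x := by linarith
  have hΓ : 0 < Real.Gamma (1 + x) := Real.Gamma_pos_of_pos h1
  have hslope := Real.convexOn_log_Gamma.slope_mono_adjacent (x := 1) (y := 1 + x)
    (z := 1 + x + 1) (Set.mem_Ioi.2 one_pos) (Set.mem_Ioi.2 (by linarith)) (by linarith)
    (by linarith)
  simp only [Function.comp_apply, Real.Gamma_add_one h1.ne', Real.log_mul h1.ne' hΓ.ne',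
    Real.Gamma_one, Real.log_one, add_sub_cancel_left, add_sub_cancel_right, sub_zero,
    div_one] at hslope
  rw [div_le_iff₀ hx] at hslope
  rwa [Real.rpow_def_of_pos h1, ← Real.log_le_iff_le_exp hΓ]

/-- for every real `x ≥ 0`, `(x/e)^x ≤ Γ(1+x) ≤ (1+x)^x`
(real powers, so `(0/e)^0 = 1` by the `rpow` convention). -/
theorem stmt_2 (x : ℝ) (hx : 0 ≤ x) :
    (x / Real.exp 1) ^ x ≤ Real.Gamma (1 + x) ∧
      Real.Gamma (1 + x) ≤ (1 + x) ^ x :=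
  ⟨div_exp_rpow_le_Gamma_one_add hx, Gamma_one_add_le_one_add_rpow hx⟩
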